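/- arXiv:2207.11998 — 5 statements merged into one kernel-verified Lean document; each statement's English description precedes it below -/
import Mathlib

section
/- For every integer n, D(8π/3 + 8πn) = 0 and D(−8π/3 + 8πn) = 0, i.e. all k of the form ±8π/3 + 8πn are zeros of the secular function D of the lollipop quantum graph. -/
/-- The edge scattering matrix of the lollipop graph of total length 1
(four edges of length 1/4). -/
noncomputable def Se (k : ℝ) : Matrix (Fin 8) (Fin 8) ℂ :=
  let e : ℂ := Complex.exp (Complex.I * k / 4)
  !![0, e, 0, 0, 0, 0, 0, 0;
     e, 0, 0, 0, 0, 0, 0, 0;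
     0, 0, 0, e, 0, 0, 0, 0;
     0, 0, e, 0, 0, 0, 0, 0;
     0, 0, 0, 0, 0, e, 0, 0;
     0, 0, 0, 0, e, 0, 0, 0;
     0, 0, 0, 0, 0, 0, 0, e;
     0, 0, 0, 0, 0, 0, e, 0]

/-- The vertex scattering matrix of the lollipop graph. -/
noncomputable def Sv : Matrix (Fin 8) (Fin 8) ℂ :=
  !![-1/3, 0, 0, 0, 0, 2/3, 2/3, 0;
     0, 0, 1, 0, 0, 0, 0, 0;
     0, 1, 0, 0, 0, 0, 0, 0;
     0, 0, 0, 0, 1, 0, 0, 0;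
     0, 0, 0, 1, 0, 0, 0, 0;
     2/3, 0, 0, 0, 0, -1/3, 2/3, 0;
     2/3, 0, 0, 0, 0, 2/3, -1/3, 0;
     0, 0, 0, 0, 0, 0, 0, 1]

/-- The secular function of the lollipop graph. -/
noncomputable def D (k : ℝ) : ℂ := (Se k * Sv - 1).det

/-- If `exp (i k / 4)` is a cube root of unity, the eigenfunction supported on the cycle and
vanishing at the vertex of degree three shows that the secular function vanishes at `k`. -/
theorem D_eq_zero_of_exp_pow_three_eq_one {k : ℝ}
    (h : Complex.exp (Complex.I * k / 4) ^ 3 = 1) : D k = 0 := by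
  unfold D
  rw [← Matrix.exists_mulVec_eq_zero_iff]
  generalize he : Complex.exp (Complex.I * k / 4) = e at h
  refine ⟨![1, -e, e ^ 2, -e ^ 2, e, -1, 0, 0], fun hv => ?_, ?_⟩
  · simpa using congrFun hv 0
  · rw [Matrix.sub_mulVec, ← Matrix.mulVec_mulVec, Matrix.one_mulVec, sub_eq_zero]
    have hSv : Sv.mulVec ![1, -e, e ^ 2, -e ^ 2, e, -1, 0, 0] =
        ![-1, e ^ 2, -e, e, -e ^ 2, 1, 0, 0] := by
      ext i
      fin_cases i <;> simp [Sv, Matrix.mulVec, dotProduct, Fin.sum_univ_succ] <;> norm_num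
    rw [hSv]
    ext i
    fin_cases i <;> simp [Se, he, Matrix.mulVec, dotProduct, Fin.sum_univ_succ] <;>
      first | ring1 | linear_combination h

theorem lollipop_secular_zero_at_pm_8pi_div_3 (n : ℤ) :
    D (8 * Real.pi / 3 + 8 * Real.pi * n) = 0 ∧
    D (-(8 * Real.pi / 3) + 8 * Real.pi * n) = 0 := by
  constructor <;> apply D_eq_zero_of_exp_pow_three_eq_one <;>
    rw [← Complex.exp_nat_mul, Complex.exp_eq_one_iff]
  · exact ⟨1 + 3 * n, by push_cast; ring⟩
  · exact ⟨-1 + 3 * n, by push_cast; ring⟩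
end

section
/- Let z₁ = (1/12)(−3−√33 − i√(102−6√33)) and let z̄₁ = (1/12)(−3−√33 + i√(102−6√33)) be its complex conjugate. For every integer n, the real numbers k = −4i·Log(z₁) + 8πn and k = −4i·Log(z̄₁) + 8πn satisfy D(k) = 0, where Log is the principal complex logarithm. -/
noncomputable def z₁ : ℂ :=
  (1/12) * (-3 - (Real.sqrt 33 : ℂ) - Complex.I * (Real.sqrt (102 - 6 * Real.sqrt 33) : ℂ))

noncomputable def z₁conj : ℂ :=
  (1/12) * (-3 - (Real.sqrt 33 : ℂ) + Complex.I * (Real.sqrt (102 - 6 * Real.sqrt 33) : ℂ))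

theorem Se_mulVec (k : ℝ) (v : Fin 8 → ℂ) :
    (Se k).mulVec v = Complex.exp (Complex.I * k / 4) •
      ![v 1, v 0, v 3, v 2, v 5, v 4, v 7, v 6] := by
  ext i
  fin_cases i <;> simp [Se, Matrix.mulVec, dotProduct, Fin.sum_univ_eight]

theorem Sv_mulVec (v : Fin 8 → ℂ) :
    Sv.mulVec v = ![-1 / 3 * v 0 + 2 / 3 * v 5 + 2 / 3 * v 6, v 2, v 1, v 4, v 3,
      2 / 3 * v 0 + -1 / 3 * v 5 + 2 / 3 * v 6, 2 / 3 * v 0 + 2 / 3 * v 5 + -1 / 3 * v 6, v 7] := by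
  ext i
  fin_cases i <;> simp [Sv, Matrix.mulVec, dotProduct, Fin.sum_univ_eight]

/-- If `exp (i k / 4)` is a root of `3 z⁴ + 3 z³ + 4 z² + 3 z + 3`, an eigenvector supported
symmetrically on the cycle shows that the secular function vanishes at `k`. -/
theorem D_eq_zero_of_exp_root (k : ℝ) (z : ℂ) (hz : Complex.exp (Complex.I * k / 4) = z)
    (h : 3 * z ^ 4 + 3 * z ^ 3 + 4 * z ^ 2 + 3 * z + 3 = 0) : D k = 0 := by
  have hz0 : z ≠ 0 := hz ▸ Complex.exp_ne_zero _
  unfold D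
  rw [← Matrix.exists_mulVec_eq_zero_iff]
  refine ⟨![2 * z ^ 5, 2 * z ^ 3, 2 * z ^ 4, 2 * z ^ 4, 2 * z ^ 3, 2 * z ^ 5,
    z ^ 2 * (3 - z ^ 3), z * (3 - z ^ 3)], ?_, ?_⟩
  · intro h0
    have h1 := congrFun h0 1
    simp [hz0] at h1
  · rw [Matrix.sub_mulVec, ← Matrix.mulVec_mulVec, Matrix.one_mulVec, Sv_mulVec, Se_mulVec, hz]
    ext i
    fin_cases i <;> simp <;>
      first
        | ring1
        | linear_combination (z * (z - 1)) * h

theorem sq_sqrt_thirtyThree : ((Real.sqrt 33 : ℝ) : ℂ) ^ 2 = 33 := by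
  exact_mod_cast Real.sq_sqrt (show (0 : ℝ) ≤ 33 by norm_num)

theorem sq_sqrt_discriminant :
    ((Real.sqrt (102 - 6 * Real.sqrt 33) : ℝ) : ℂ) ^ 2 = 102 - 6 * (Real.sqrt 33 : ℂ) := by
  have h : Real.sqrt 33 ≤ 17 := Real.sqrt_le_iff.mpr (by norm_num)
  exact_mod_cast Real.sq_sqrt (show (0 : ℝ) ≤ 102 - 6 * Real.sqrt 33 by linarith)

theorem quartic_eq_zero_of_sq {z a : ℂ} (ha : a ^ 2 = 33)
    (hz : z ^ 2 + (3 + a) / 6 * z + 1 = 0) :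
    3 * z ^ 4 + 3 * z ^ 3 + 4 * z ^ 2 + 3 * z + 3 = 0 := by
  linear_combination 3 * (z ^ 2 + (3 - a) / 6 * z + 1) * hz + z ^ 2 / 12 * ha

theorem z₁_root : z₁ ^ 2 + (3 + (Real.sqrt 33 : ℂ)) / 6 * z₁ + 1 = 0 := by
  unfold z₁
  linear_combination (-1 / 144 : ℂ) * sq_sqrt_thirtyThree - (1 / 144 : ℂ) * sq_sqrt_discriminant
    + (Real.sqrt (102 - 6 * Real.sqrt 33) : ℂ) ^ 2 / 144 * Complex.I_sq

theorem z₁conj_root : z₁conj ^ 2 + (3 + (Real.sqrt 33 : ℂ)) / 6 * z₁conj + 1 = 0 := by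
  unfold z₁conj
  linear_combination (-1 / 144 : ℂ) * sq_sqrt_thirtyThree - (1 / 144 : ℂ) * sq_sqrt_discriminant
    + (Real.sqrt (102 - 6 * Real.sqrt 33) : ℂ) ^ 2 / 144 * Complex.I_sq

theorem exp_quarter_eq_of_eq_log {z : ℂ} (hz : z ≠ 0) (n : ℤ) (k : ℝ)
    (hk : (k : ℂ) = -4 * Complex.I * Complex.log z + 8 * Real.pi * n) :
    Complex.exp (Complex.I * k / 4) = z := by
  have h : Complex.I * k / 4 = Complex.log z + n * (2 * Real.pi * Complex.I) := by
    rw [hk]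
    linear_combination -Complex.log z * Complex.I_sq
  rw [h, Complex.exp_add, Complex.exp_int_mul_two_pi_mul_I, mul_one, Complex.exp_log hz]

theorem D_eq_zero_of_eq_log {z : ℂ} (hz : z ^ 2 + (3 + (Real.sqrt 33 : ℂ)) / 6 * z + 1 = 0)
    (n : ℤ) (k : ℝ) (hk : (k : ℂ) = -4 * Complex.I * Complex.log z + 8 * Real.pi * n) :
    D k = 0 := by
  have hz0 : z ≠ 0 := by
    rintro rfl
    norm_num at hz
  exact D_eq_zero_of_exp_root k z (exp_quarter_eq_of_eq_log hz0 n k hk)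
    (quartic_eq_zero_of_sq sq_sqrt_thirtyThree hz)

theorem lollipop_secular_zero_z₁_family (n : ℤ) (k k' : ℝ)
    (hk : (k : ℂ) = -4 * Complex.I * Complex.log z₁ + 8 * Real.pi * n)
    (hk' : (k' : ℂ) = -4 * Complex.I * Complex.log z₁conj + 8 * Real.pi * n) :
    D k = 0 ∧ D k' = 0 := by
  exact ⟨D_eq_zero_of_eq_log z₁_root n k hk, D_eq_zero_of_eq_log z₁conj_root n k' hk'⟩
end

section
/- A real number k satisfies D(k) = 0 if and only if k belongs to the set { 8πn, 8π/3 + 8πn, −8π/3 + 8πn, −4i·Log(z₁) + 8πn, −4i·Log(z̄₁) + 8πn, −4i·Log(z₂) + 8πn, −4i·Log(z̄₂) + 8πn : n ∈ ℤ }, where z₁ = (1/12)(−3−√33 − i√(102−6√33)), z₂ = (1/12)(−3+√33 − i√(102+6√33)), z̄₁, z̄₂ are their complex conjugates, and Log is the principal complex logarithm. -/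
noncomputable def z₂ : ℂ :=
  (1/12) * (-3 + (Real.sqrt 33 : ℂ) - Complex.I * (Real.sqrt (102 + 6 * Real.sqrt 33) : ℂ))

set_option maxHeartbeats 1000000 in
/-- Each determinant size is expanded separately, so that minors with coefficient `0` are discarded
before they are expanded. -/
lemma D_eq (k : ℝ) : D k = (Complex.exp (Complex.I * k / 4) - 1) *
    (Complex.exp (Complex.I * k / 4) ^ 3 - 1) *
    (Complex.exp (Complex.I * k / 4) ^ 4 + Complex.exp (Complex.I * k / 4) ^ 3 +
      4 / 3 * Complex.exp (Complex.I * k / 4) ^ 2 + Complex.exp (Complex.I * k / 4) + 1) := by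
  unfold D Se Sv
  generalize Complex.exp (Complex.I * k / 4) = e
  have h : ((!![0, e, 0, 0, 0, 0, 0, 0;
     e, 0, 0, 0, 0, 0, 0, 0;
     0, 0, 0, e, 0, 0, 0, 0;
     0, 0, e, 0, 0, 0, 0, 0;
     0, 0, 0, 0, 0, e, 0, 0;
     0, 0, 0, 0, e, 0, 0, 0;
     0, 0, 0, 0, 0, 0, 0, e;
     0, 0, 0, 0, 0, 0, e, 0] * !![-1/3, 0, 0, 0, 0, 2/3, 2/3, 0;
     0, 0, 1, 0, 0, 0, 0, 0;
     0, 1, 0, 0, 0, 0, 0, 0;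
     0, 0, 0, 0, 1, 0, 0, 0;
     0, 0, 0, 1, 0, 0, 0, 0;
     2/3, 0, 0, 0, 0, -1/3, 2/3, 0;
     2/3, 0, 0, 0, 0, 2/3, -1/3, 0;
     0, 0, 0, 0, 0, 0, 0, 1] - 1 : Matrix (Fin 8) (Fin 8) ℂ)) = !![-1, 0, e, 0, 0, 0, 0, 0;
   e*(-1/3), -1, 0, 0, 0, e*(2/3), e*(2/3), 0;
   0, 0, -1, 0, e, 0, 0, 0;
   0, e, 0, -1, 0, 0, 0, 0;
   e*(2/3), 0, 0, 0, -1, e*(-1/3), e*(2/3), 0;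
   0, 0, 0, e, 0, -1, 0, 0;
   0, 0, 0, 0, 0, 0, -1, e;
   e*(2/3), 0, 0, 0, 0, e*(2/3), e*(-1/3), -1] := by
    ext i j
    fin_cases i <;> fin_cases j <;> simp
  dsimp only
  rw [h]
  simp [Matrix.det_succ_row_zero (n := 7), Fin.sum_univ_succ]
  simp [Matrix.det_succ_row_zero (n := 6), Fin.sum_univ_succ, Fin.succAbove]
  simp [Matrix.det_succ_row_zero (n := 5), Fin.sum_univ_succ, Fin.succAbove]
  simp [Matrix.det_succ_row_zero (n := 4), Fin.sum_univ_succ, Fin.succAbove]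
  simp [Matrix.det_succ_row_zero (n := 3), Fin.sum_univ_succ, Fin.succAbove]
  simp [Matrix.det_succ_row_zero, Fin.sum_univ_succ, Fin.succAbove]
  ring

open Complex in
lemma exp_I_mul_div_four_eq_exp_iff {k : ℝ} {w : ℂ} :
    exp (I * k / 4) = exp w ↔ ∃ n : ℤ, (k : ℂ) = -4 * I * w + 8 * Real.pi * n := by
  rw [exp_eq_exp_iff_exists_int]
  refine exists_congr fun n ↦ ⟨fun h ↦ ?_, fun h ↦ ?_⟩
  · linear_combination (-4 * I) * h + (k - 8 * Real.pi * n) * I_sq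
  · rw [h]
    linear_combination (-w) * I_sq

lemma sqrt_thirty_three_bounds : 5 < Real.sqrt 33 ∧ Real.sqrt 33 < 6 := by
  constructor
  · rw [Real.lt_sqrt] <;> norm_num
  · rw [Real.sqrt_lt'] <;> norm_num

lemma ofReal_sqrt_sq {x : ℝ} (hx : 0 ≤ x) : ((Real.sqrt x : ℝ) : ℂ) ^ 2 = x := by
  exact_mod_cast Real.sq_sqrt hx

lemma z₁_add_conj : z₁ + starRingEnd ℂ z₁ = -(3 + (Real.sqrt 33 : ℂ)) / 6 := by
  simp only [z₁, map_mul, map_sub, map_neg, map_div₀, map_one, map_ofNat, Complex.conj_ofReal,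
    Complex.conj_I]
  ring

lemma z₂_add_conj : z₂ + starRingEnd ℂ z₂ = (-3 + (Real.sqrt 33 : ℂ)) / 6 := by
  simp only [z₂, map_mul, map_sub, map_add, map_neg, map_div₀, map_one, map_ofNat,
    Complex.conj_ofReal, Complex.conj_I]
  ring

lemma z₁_mul_conj : z₁ * starRingEnd ℂ z₁ = 1 := by
  have h := ofReal_sqrt_sq (show (0 : ℝ) ≤ 33 by norm_num)
  have h' := ofReal_sqrt_sq (show (0 : ℝ) ≤ 102 - 6 * Real.sqrt 33 by
    linarith [sqrt_thirty_three_bounds.2])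
  push_cast at h h'
  simp only [z₁, map_mul, map_sub, map_neg, map_div₀, map_one, map_ofNat, Complex.conj_ofReal,
    Complex.conj_I]
  linear_combination (1 / 144) * h + (1 / 144) * h' -
    (1 / 144) * (Real.sqrt (102 - 6 * Real.sqrt 33) : ℂ) ^ 2 * Complex.I_sq

lemma z₂_mul_conj : z₂ * starRingEnd ℂ z₂ = 1 := by
  have h := ofReal_sqrt_sq (show (0 : ℝ) ≤ 33 by norm_num)
  have h' := ofReal_sqrt_sq (show (0 : ℝ) ≤ 102 + 6 * Real.sqrt 33 by positivity)
  push_cast at h h'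
  simp only [z₂, map_mul, map_sub, map_add, map_neg, map_div₀, map_one, map_ofNat,
    Complex.conj_ofReal, Complex.conj_I]
  linear_combination (1 / 144) * h + (1 / 144) * h' -
    (1 / 144) * (Real.sqrt (102 + 6 * Real.sqrt 33) : ℂ) ^ 2 * Complex.I_sq

lemma quartic_factorization (e : ℂ) : e ^ 4 + e ^ 3 + 4 / 3 * e ^ 2 + e + 1 =
    (e - z₁) * (e - starRingEnd ℂ z₁) * ((e - z₂) * (e - starRingEnd ℂ z₂)) := by
  have h := ofReal_sqrt_sq (show (0 : ℝ) ≤ 33 by norm_num)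
  push_cast at h
  have h₁ : (e - z₁) * (e - starRingEnd ℂ z₁) = e ^ 2 + (3 + (Real.sqrt 33 : ℂ)) / 6 * e + 1 := by
    linear_combination -e * z₁_add_conj + z₁_mul_conj
  have h₂ : (e - z₂) * (e - starRingEnd ℂ z₂) = e ^ 2 - (-3 + (Real.sqrt 33 : ℂ)) / 6 * e + 1 := by
    linear_combination -e * z₂_add_conj + z₂_mul_conj
  rw [h₁, h₂]
  linear_combination e ^ 2 / 36 * h

open Complex in
lemma cube_sub_one_factorization (e : ℂ) : e ^ 3 - 1 =
    (e - 1) * (e - exp (2 * Real.pi / 3 * I)) * (e - exp (-(2 * Real.pi / 3 * I))) := by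
  have hmul : exp (2 * Real.pi / 3 * I) * exp (-(2 * Real.pi / 3 * I)) = 1 := by
    rw [← exp_add, add_neg_cancel, exp_zero]
  have hadd : exp (2 * Real.pi / 3 * I) + exp (-(2 * Real.pi / 3 * I)) = -1 := by
    have hcos : Real.cos (2 * Real.pi / 3) = -(1 / 2) := by
      rw [show 2 * Real.pi / 3 = Real.pi - Real.pi / 3 by ring, Real.cos_pi_sub,
        Real.cos_pi_div_three]
    have h := two_cos (2 * Real.pi / 3)
    have hcos' : cos (2 * Real.pi / 3) = -(1 / 2) := by
      simpa using congrArg ofReal hcos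
    rw [hcos', neg_mul] at h
    linear_combination -h
  linear_combination (e - 1) * (e * hadd - hmul)

theorem lollipop_secular_zeros_characterization (k : ℝ) :
    D k = 0 ↔
      ∃ n : ℤ,
        k = 8 * Real.pi * n ∨
        k = 8 * Real.pi / 3 + 8 * Real.pi * n ∨
        k = -(8 * Real.pi / 3) + 8 * Real.pi * n ∨
        (k : ℂ) = -4 * Complex.I * Complex.log z₁ + 8 * Real.pi * n ∨
        (k : ℂ) = -4 * Complex.I * Complex.log (starRingEnd ℂ z₁) + 8 * Real.pi * n ∨
        (k : ℂ) = -4 * Complex.I * Complex.log z₂ + 8 * Real.pi * n ∨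
        (k : ℂ) = -4 * Complex.I * Complex.log (starRingEnd ℂ z₂) + 8 * Real.pi * n := by
  have r₀ (n : ℤ) : k = 8 * Real.pi * n ↔
      (k : ℂ) = -4 * Complex.I * 0 + 8 * Real.pi * n := by
    rw [mul_zero, zero_add]
    exact_mod_cast Iff.rfl
  have r₁ (n : ℤ) : k = 8 * Real.pi / 3 + 8 * Real.pi * n ↔
      (k : ℂ) = -4 * Complex.I * (2 * Real.pi / 3 * Complex.I) + 8 * Real.pi * n := by
    rw [show -4 * Complex.I * (2 * Real.pi / 3 * Complex.I) = 8 * Real.pi / 3 by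
      linear_combination (-8 * Real.pi / 3) * Complex.I_sq]
    exact_mod_cast Iff.rfl
  have r₂ (n : ℤ) : k = -(8 * Real.pi / 3) + 8 * Real.pi * n ↔
      (k : ℂ) = -4 * Complex.I * -(2 * Real.pi / 3 * Complex.I) + 8 * Real.pi * n := by
    rw [show -4 * Complex.I * -(2 * Real.pi / 3 * Complex.I) = -(8 * Real.pi / 3) by
      linear_combination (8 * Real.pi / 3) * Complex.I_sq]
    exact_mod_cast Iff.rfl
  have hz₁ := mul_ne_zero_iff.mp (z₁_mul_conj ▸ one_ne_zero)
  have hz₂ := mul_ne_zero_iff.mp (z₂_mul_conj ▸ one_ne_zero)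
  rw [D_eq, cube_sub_one_factorization, quartic_factorization]
  simp only [r₀, r₁, r₂, exists_or, mul_eq_zero, sub_eq_zero,
    ← exp_I_mul_div_four_eq_exp_iff, Complex.exp_zero, Complex.exp_log hz₁.1,
    Complex.exp_log hz₁.2, Complex.exp_log hz₂.1, Complex.exp_log hz₂.2]
  tauto
end

section
/- A real number k satisfies D_Δ(k) = 0 if and only if k = 2πn for some integer n, where D_Δ is the secular function of the equilateral triangle graph of total length 1 (obtained from the lollipop graph by letting the pendant edge length go to 0). -/
/-- The edge scattering matrix of the equilateral triangle graph of total length 1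
(three edges of length 1/3 and one degenerate edge of length 0). -/
noncomputable def SeΔ (k : ℝ) : Matrix (Fin 8) (Fin 8) ℂ :=
  let e : ℂ := Complex.exp (Complex.I * k / 3)
  !![0, e, 0, 0, 0, 0, 0, 0;
     e, 0, 0, 0, 0, 0, 0, 0;
     0, 0, 0, e, 0, 0, 0, 0;
     0, 0, e, 0, 0, 0, 0, 0;
     0, 0, 0, 0, 0, e, 0, 0;
     0, 0, 0, 0, e, 0, 0, 0;
     0, 0, 0, 0, 0, 0, 0, 1;
     0, 0, 0, 0, 0, 0, 1, 0]

/-- The secular function of the equilateral triangle graph of total length 1. -/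
noncomputable def DΔ (k : ℝ) : ℂ := (SeΔ k * Sv - 1).det

/-- The matrix `S_e S_v - 1` of the triangle, with `z` the phase acquired along one edge. -/
noncomputable def secularMatrix (z : ℂ) : Matrix (Fin 8) (Fin 8) ℂ :=
  !![-1, 0, z, 0, 0, 0, 0, 0;
     -z/3, -1, 0, 0, 0, 2*z/3, 2*z/3, 0;
     0, 0, -1, 0, z, 0, 0, 0;
     0, z, 0, -1, 0, 0, 0, 0;
     2*z/3, 0, 0, 0, -1, -z/3, 2*z/3, 0;
     0, 0, 0, z, 0, -1, 0, 0;
     0, 0, 0, 0, 0, 0, -1, 1;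
     2/3, 0, 0, 0, 0, 2/3, -1/3, -1]

theorem SeΔ_mul_Sv_sub_one (k : ℝ) :
    SeΔ k * Sv - 1 = secularMatrix (Complex.exp (Complex.I * k / 3)) := by
  ext i j
  rw [Matrix.sub_apply, Matrix.mul_apply]
  fin_cases i <;> fin_cases j <;>
    simp [SeΔ, Sv, secularMatrix, Fin.sum_univ_eight] <;> ring

/-- An ordering of the eight edge ends for which Gaussian elimination on `secularMatrix`
needs no pivoting. -/
def eliminationOrder : Equiv.Perm (Fin 8) where
  toFun := ![0, 2, 5, 3, 6, 7, 4, 1]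
  invFun := ![0, 7, 1, 3, 6, 2, 4, 5]
  left_inv := by decide
  right_inv := by decide

/-- The matrix `secularMatrix` with rows and columns permuted by `eliminationOrder`. -/
noncomputable def orderedSecularMatrix (z : ℂ) : Matrix (Fin 8) (Fin 8) ℂ :=
  !![-1, z, 0, 0, 0, 0, 0, 0;
     0, -1, 0, 0, 0, 0, z, 0;
     0, 0, -1, z, 0, 0, 0, 0;
     0, 0, 0, -1, 0, 0, 0, z;
     0, 0, 0, 0, -1, 1, 0, 0;
     2/3, 0, 2/3, 0, -1/3, -1, 0, 0;
     2*z/3, 0, -z/3, 0, 2*z/3, 0, -1, 0;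
     -z/3, 0, 2*z/3, 0, 2*z/3, 0, 0, -1]

theorem submatrix_secularMatrix (z : ℂ) :
    (secularMatrix z).submatrix eliminationOrder eliminationOrder = orderedSecularMatrix z := by
  ext i j
  fin_cases i <;> fin_cases j <;> rfl

/-- The column operations that make `orderedSecularMatrix` lower triangular. -/
noncomputable def columnOperations (z : ℂ) : Matrix (Fin 8) (Fin 8) ℂ :=
  !![1, z, 0, 0, 0, 0, z^2, 0;
     0, 1, 0, 0, 0, 0, z, 0;
     0, 0, 1, z, 0, 0, 0, z^2;
     0, 0, 0, 1, 0, 0, 0, z;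
     0, 0, 0, 0, 1, 1, z^2/2, z^2/2;
     0, 0, 0, 0, 0, 1, z^2/2, z^2/2;
     0, 0, 0, 0, 0, 0, 1, 0;
     0, 0, 0, 0, 0, 0, 0, 1]

/-- The lower triangular form of `orderedSecularMatrix`. -/
noncomputable def triangularForm (z : ℂ) : Matrix (Fin 8) (Fin 8) ℂ :=
  !![-1, 0, 0, 0, 0, 0, 0, 0;
     0, -1, 0, 0, 0, 0, 0, 0;
     0, 0, -1, 0, 0, 0, 0, 0;
     0, 0, 0, -1, 0, 0, 0, 0;
     0, 0, 0, 0, -1, 0, 0, 0;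
     2/3, 2*z/3, 2/3, 2*z/3, -1/3, -4/3, 0, 0;
     2*z/3, 2*z^2/3, -z/3, -z^2/3, 2*z/3, 2*z/3, z^3-1, 0;
     -z/3, -z^2/3, 2*z/3, 2*z^2/3, 2*z/3, 2*z/3, 0, z^3-1]

set_option maxHeartbeats 1000000 in
theorem orderedSecularMatrix_mul_columnOperations (z : ℂ) :
    orderedSecularMatrix z * columnOperations z = triangularForm z := by
  ext i j
  rw [Matrix.mul_apply]
  fin_cases i <;> fin_cases j <;>
    simp [orderedSecularMatrix, columnOperations, triangularForm, Fin.sum_univ_eight] <;> ring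

theorem det_columnOperations (z : ℂ) : (columnOperations z).det = 1 := by
  rw [Matrix.det_of_isUpperTriangular]
  · simp [columnOperations, Fin.prod_univ_eight]
  · intro i j h
    fin_cases i <;> fin_cases j <;> first | rfl | exact absurd h (by decide)

theorem det_triangularForm (z : ℂ) : (triangularForm z).det = 4 / 3 * (z ^ 3 - 1) ^ 2 := by
  rw [Matrix.det_of_isLowerTriangular]
  · simp [triangularForm, Fin.prod_univ_eight]
    ring
  · intro i j h
    fin_cases i <;> fin_cases j <;> first | rfl | exact absurd h (by decide)

theorem det_secularMatrix (z : ℂ) : (secularMatrix z).det = 4 / 3 * (z ^ 3 - 1) ^ 2 := by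
  rw [← Matrix.det_submatrix_equiv_self eliminationOrder, submatrix_secularMatrix,
    ← det_triangularForm, ← orderedSecularMatrix_mul_columnOperations, Matrix.det_mul,
    det_columnOperations, mul_one]

theorem DΔ_eq (k : ℝ) : DΔ k = 4 / 3 * (Complex.exp (Complex.I * k) - 1) ^ 2 := by
  have hz : Complex.exp (Complex.I * k) = Complex.exp (Complex.I * k / 3) ^ 3 := by
    rw [← Complex.exp_nat_mul]
    congr 1
    push_cast
    ring
  rw [DΔ, SeΔ_mul_Sv_sub_one, det_secularMatrix, hz]

theorem triangle_secular_zeros (k : ℝ) :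
    DΔ k = 0 ↔ ∃ n : ℤ, k = 2 * Real.pi * n := by
  have hk : DΔ k = 0 ↔ Complex.exp (Complex.I * k) = 1 := by
    rw [DΔ_eq]
    simp [sub_eq_zero]
  rw [hk, Complex.exp_eq_one_iff]
  refine exists_congr fun n => ?_
  rw [show (n : ℂ) * (2 * Real.pi * Complex.I) = Complex.I * (2 * Real.pi * n : ℝ) by
    push_cast; ring, mul_right_inj' Complex.I_ne_zero, Complex.ofReal_inj]
end

section
/- Let k > 0 be real. There exist twice continuously differentiable functions u : [0, 3/4] → ℝ and v : [0, 1/4] → ℝ, not both identically zero, satisfying −u'' = k²·u on [0, 3/4], −v'' = k²·v on [0, 1/4], the continuity conditions u(0) = u(3/4) = v(0), the Kirchhoff condition u'(0) − u'(3/4) + v'(0) = 0, and the Neumann condition v'(1/4) = 0, if and only if k belongs to the set { 8πn, 8π/3 + 8πn, −8π/3 + 8πn, −4i·Log(z₁) + 8πn, −4i·Log(z̄₁) + 8πn, −4i·Log(z₂) + 8πn, −4i·Log(z̄₂) + 8πn : n ∈ ℤ }, where z₁ = (1/12)(−3−√33 − i√(102−6√33)), z₂ = (1/12)(−3+√33 −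 i√(102+6√33)), z̄₁, z̄₂ are their complex conjugates, and Log is the principal complex logarithm. -/
/-- A `C²` solution of `-f'' = k² f` on `[0, a]` is the trigonometric function determined by its
initial data, and so is its derivative. -/
theorem eq_cos_add_sin_of_harmonic {a k : ℝ} (ha : 0 < a) (hk : 0 < k) {f : ℝ → ℝ}
    (hf : ContDiffOn ℝ 2 f (Set.Icc 0 a))
    (hode : ∀ x ∈ Set.Icc (0:ℝ) a,
      -derivWithin (derivWithin f (Set.Icc 0 a)) (Set.Icc 0 a) x = k ^ 2 * f x) :
    ∃ B : ℝ, ∀ x ∈ Set.Icc (0:ℝ) a,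
      f x = f 0 * Real.cos (k * x) + B * Real.sin (k * x) ∧
      derivWithin f (Set.Icc 0 a) x =
        k * (-f 0 * Real.sin (k * x) + B * Real.cos (k * x)) := by
  set s := Set.Icc (0:ℝ) a with hs
  set g := derivWithin f s with hg
  have hu : UniqueDiffOn ℝ s := uniqueDiffOn_Icc ha
  have hfd : ∀ x ∈ s, HasDerivWithinAt f (g x) s x := fun x hx =>
    (hf.differentiableOn (by norm_num) x hx).hasDerivWithinAt
  have hgd : ∀ x ∈ s, HasDerivWithinAt g (-(k ^ 2 * f x)) s x := fun x hx => by
    have h := ((hf.derivWithin hu (m := 1) (by norm_num)).differentiableOn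
      (by norm_num) x hx).hasDerivWithinAt
    rwa [← hg, show derivWithin g s x = -(k ^ 2 * f x) by rw [← hode x hx, neg_neg]] at h
  have hsin : ∀ x, HasDerivWithinAt (fun x => Real.sin (k * x)) (Real.cos (k * x) * k) s x :=
    fun x => ((hasDerivAt_id x).const_mul k).sin.hasDerivWithinAt.congr_deriv (by simp)
  have hcos : ∀ x, HasDerivWithinAt (fun x => Real.cos (k * x)) (-Real.sin (k * x) * k) s x :=
    fun x => ((hasDerivAt_id x).const_mul k).cos.hasDerivWithinAt.congr_deriv (by simp)
  have hp : ∀ x ∈ s, HasDerivWithinAt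
      (fun x => k * f x * Real.cos (k * x) - g x * Real.sin (k * x)) 0 s x := fun x hx =>
    ((((hfd x hx).const_mul k).mul (hcos x)).sub ((hgd x hx).mul (hsin x))).congr_deriv (by ring)
  have hq : ∀ x ∈ s, HasDerivWithinAt
      (fun x => k * f x * Real.sin (k * x) + g x * Real.cos (k * x)) 0 s x := fun x hx =>
    ((((hfd x hx).const_mul k).mul (hsin x)).add ((hgd x hx).mul (hcos x))).congr_deriv (by ring)
  have hconst : ∀ F : ℝ → ℝ, (∀ x ∈ s, HasDerivWithinAt F 0 s x) → ∀ x ∈ s, F x = F 0 :=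
    fun F hF => constant_of_derivWithin_zero (fun x hx => (hF x hx).differentiableWithinAt)
      fun x hx => (hF x ⟨hx.1, hx.2.le⟩).derivWithin (hu x ⟨hx.1, hx.2.le⟩)
  refine ⟨g 0 / k, fun x hx => ?_⟩
  have h1 := hconst _ hp x hx
  have h2 := hconst _ hq x hx
  have h3 := Real.sin_sq_add_cos_sq (k * x)
  simp only [mul_zero, Real.cos_zero, Real.sin_zero, mul_one, sub_zero, zero_add] at h1 h2
  constructor
  · field_simp
    linear_combination Real.cos (k * x) * h1 + Real.sin (k * x) * h2 - k * f x * h3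
  · field_simp
    linear_combination Real.cos (k * x) * h2 - Real.sin (k * x) * h1 - g x * h3

theorem derivWithin_cos_add_sin {a x : ℝ} (k A B : ℝ) (ha : 0 < a) (hx : x ∈ Set.Icc 0 a) :
    derivWithin (fun x => A * Real.cos (k * x) + B * Real.sin (k * x)) (Set.Icc 0 a) x =
      k * B * Real.cos (k * x) + -(k * A) * Real.sin (k * x) := by
  have hsin := ((hasDerivAt_id x).const_mul k).sin
  have hcos := ((hasDerivAt_id x).const_mul k).cos
  refine (((hcos.const_mul A).add (hsin.const_mul B)).hasDerivWithinAt.congr_deriv ?_).derivWithin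
    (uniqueDiffOn_Icc ha x hx)
  simp only [id]
  ring

theorem neg_derivWithin_derivWithin_cos_add_sin {a x : ℝ} (k A B : ℝ) (ha : 0 < a)
    (hx : x ∈ Set.Icc 0 a) :
    -derivWithin (derivWithin (fun x => A * Real.cos (k * x) + B * Real.sin (k * x))
      (Set.Icc 0 a)) (Set.Icc 0 a) x =
      k ^ 2 * (A * Real.cos (k * x) + B * Real.sin (k * x)) := by
  rw [derivWithin_congr (fun y hy => derivWithin_cos_add_sin k A B ha hy)
    (derivWithin_cos_add_sin k A B ha hx), derivWithin_cos_add_sin k _ _ ha hx]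
  ring

/-- The linear system for the amplitudes of `u = A cos + B sin` and `v = A cos + D sin` expressing
the vertex conditions at frequency `k = 4θ`. -/
def VertexConditions (θ A B D : ℝ) : Prop :=
  A = A * Real.cos (3 * θ) + B * Real.sin (3 * θ) ∧
  B + A * Real.sin (3 * θ) - B * Real.cos (3 * θ) + D = 0 ∧
  D * Real.cos θ = A * Real.sin θ

theorem exists_lollipop_eigenfunction_iff {k : ℝ} (hk : 0 < k) :
    (∃ (u v : ℝ → ℝ),
      ContDiffOn ℝ 2 u (Set.Icc 0 (3/4)) ∧
      ContDiffOn ℝ 2 v (Set.Icc 0 (1/4)) ∧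
      (∀ x ∈ Set.Icc (0:ℝ) (3/4),
        -derivWithin (derivWithin u (Set.Icc 0 (3/4))) (Set.Icc 0 (3/4)) x = k ^ 2 * u x) ∧
      (∀ x ∈ Set.Icc (0:ℝ) (1/4),
        -derivWithin (derivWithin v (Set.Icc 0 (1/4))) (Set.Icc 0 (1/4)) x = k ^ 2 * v x) ∧
      u 0 = u (3/4) ∧ u (3/4) = v 0 ∧
      derivWithin u (Set.Icc 0 (3/4)) 0 - derivWithin u (Set.Icc 0 (3/4)) (3/4)
        + derivWithin v (Set.Icc 0 (1/4)) 0 = 0 ∧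
      derivWithin v (Set.Icc 0 (1/4)) (1/4) = 0 ∧
      ((∃ x ∈ Set.Icc (0:ℝ) (3/4), u x ≠ 0) ∨ (∃ x ∈ Set.Icc (0:ℝ) (1/4), v x ≠ 0)))
    ↔ ∃ A B D : ℝ, VertexConditions (k / 4) A B D ∧ (A ≠ 0 ∨ B ≠ 0 ∨ D ≠ 0) := by
  have e3 : k * (3 / 4) = 3 * (k / 4) := by ring
  have e1 : k * (1 / 4) = k / 4 := by ring
  have m0 : (0:ℝ) ∈ Set.Icc (0:ℝ) (3/4) := by norm_num
  have m3 : (3/4:ℝ) ∈ Set.Icc (0:ℝ) (3/4) := by norm_num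
  have n0 : (0:ℝ) ∈ Set.Icc (0:ℝ) (1/4) := by norm_num
  have n1 : (1/4:ℝ) ∈ Set.Icc (0:ℝ) (1/4) := by norm_num
  constructor
  · rintro ⟨u, v, hu, hv, hu2, hv2, h1, h2, h3, h4, h5⟩
    obtain ⟨B, hB⟩ := eq_cos_add_sin_of_harmonic (by norm_num) hk hu hu2
    obtain ⟨D, hD⟩ := eq_cos_add_sin_of_harmonic (by norm_num) hk hv hv2
    have hv0 : v 0 = u 0 := by rw [h1, h2]
    rw [hv0] at hD
    refine ⟨u 0, B, D, ⟨?_, ?_, ?_⟩, ?_⟩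
    · have := (hB _ m3).1
      rwa [← h1, e3] at this
    · rw [(hB _ m3).2, (hB _ m0).2, (hD _ n0).2, e3] at h3
      simp only [mul_zero, Real.cos_zero, Real.sin_zero] at h3
      apply mul_left_cancel₀ hk.ne'
      linear_combination h3
    · rw [(hD _ n1).2, e1] at h4
      apply mul_left_cancel₀ hk.ne'
      linear_combination h4
    · by_contra! h
      obtain ⟨hA, rfl, rfl⟩ := h
      rcases h5 with ⟨x, hx, hne⟩ | ⟨x, hx, hne⟩
      · exact hne (by rw [(hB x hx).1, hA]; ring)
      · exact hne (by rw [(hD x hx).1, hA]; ring)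
  · rintro ⟨A, B, D, ⟨h1, h2, h3⟩, hne⟩
    refine ⟨fun x => A * Real.cos (k * x) + B * Real.sin (k * x),
      fun x => A * Real.cos (k * x) + D * Real.sin (k * x), by fun_prop, by fun_prop,
      fun x hx => neg_derivWithin_derivWithin_cos_add_sin k A B (by norm_num) hx,
      fun x hx => neg_derivWithin_derivWithin_cos_add_sin k A D (by norm_num) hx,
      ?_, ?_, ?_, ?_, ?_⟩
    · simp only [e3]
      simpa using h1
    · simp only [e3]
      simpa using h1.symm
    · rw [derivWithin_cos_add_sin k A B (by norm_num) m0,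
        derivWithin_cos_add_sin k A B (by norm_num) m3,
        derivWithin_cos_add_sin k A D (by norm_num) n0, e3]
      simp only [mul_zero, Real.cos_zero, Real.sin_zero]
      linear_combination k * h2
    · rw [derivWithin_cos_add_sin k A D (by norm_num) n1, e1]
      linear_combination k * h3
    · by_contra! h
      obtain ⟨hu, hv⟩ := h
      have hA : A = 0 := by simpa using hu 0 m0
      subst hA
      set y := min (1 / 4) (Real.pi / (2 * k)) with hy
      have hy0 : 0 < y := lt_min (by norm_num) (by positivity)
      have hy1 : y ≤ 1 / 4 := min_le_left _ _
      have hyk : k * y ≤ Real.pi / 2 := by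
        calc k * y ≤ k * (Real.pi / (2 * k)) := by gcongr; exact min_le_right _ _
          _ = Real.pi / 2 := by field_simp
      have hs : Real.sin (k * y) ≠ 0 :=
        (Real.sin_pos_of_pos_of_lt_pi (by positivity) (by linarith [Real.pi_pos])).ne'
      have hB := hu y ⟨hy0.le, by linarith⟩
      have hD := hv y ⟨hy0.le, hy1⟩
      simp [hs] at hB hD
      simp [hB, hD] at hne

theorem exists_vertexConditions_iff (θ : ℝ) :
    (∃ A B D : ℝ, VertexConditions θ A B D ∧ (A ≠ 0 ∨ B ≠ 0 ∨ D ≠ 0)) ↔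
      (Real.cos θ - 1) * (2 * Real.cos θ + 1) * (6 * Real.cos θ ^ 2 + 3 * Real.cos θ - 1) = 0 := by
  have h3 : Real.sin (3 * θ) ^ 2 + Real.cos (3 * θ) ^ 2 = 1 := Real.sin_sq_add_cos_sq _
  have hP : 2 * Real.cos θ * (1 - Real.cos (3 * θ)) + Real.sin (3 * θ) * Real.sin θ =
      -((Real.cos θ - 1) * (2 * Real.cos θ + 1) *
        (6 * Real.cos θ ^ 2 + 3 * Real.cos θ - 1)) := by
    rw [Real.cos_three_mul, Real.sin_three_mul]
    linear_combination (4 * Real.cos θ ^ 2 - 4 * Real.sin θ ^ 2 - 1) * Real.sin_sq_add_cos_sq θ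
  rw [← neg_eq_zero, ← hP]
  unfold VertexConditions
  generalize Real.cos (3 * θ) = c₃ at *
  generalize Real.sin (3 * θ) = s₃ at *
  constructor
  · rintro ⟨A, B, D, ⟨h1, h2, h4⟩, hne⟩
    by_contra h
    have hB : B = 0 := by
      apply mul_right_cancel₀ h
      linear_combination (1 - c₃) * Real.cos θ * h2 - (1 - c₃) * h4
        - (Real.cos θ * s₃ + Real.sin θ) * h1 - B * Real.cos θ * h3
    have hA : A = 0 := by
      apply mul_right_cancel₀ h
      linear_combination s₃ * Real.cos θ * h2 - s₃ * h4
        + Real.cos θ * (1 - c₃) * h1 - A * Real.cos θ * h3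
    simp [hA, hB] at h2
    simp [hA, hB, h2] at hne
  · intro h
    by_cases hc : c₃ = 1
    · have hs : s₃ = 0 := by simpa [hc] using h3
      exact ⟨0, 1, 0, by simp [hc, hs], by simp⟩
    · refine ⟨Real.cos θ * s₃, Real.cos θ * (1 - c₃), Real.sin θ * s₃, ⟨by ring, ?_, by ring⟩, ?_⟩
      · linear_combination h + Real.cos θ * h3
      · have hcos : Real.cos θ ≠ 0 := fun h0 => by
          simp [h0] at hP
          simp [h0, hP] at h
        exact Or.inr (Or.inl (mul_ne_zero hcos (sub_ne_zero.mpr (Ne.symm hc))))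

theorem exists_eq_log_iff_cos_eq_re {z : ℂ} (hz : ‖z‖ = 1) (him : z.im ≠ 0) (k : ℝ) :
    (∃ n : ℤ, (k : ℂ) = -4 * Complex.I * Complex.log z + 8 * Real.pi * n ∨
      (k : ℂ) = -4 * Complex.I * Complex.log (starRingEnd ℂ z) + 8 * Real.pi * n) ↔
      Real.cos (k / 4) = z.re := by
  have hz0 : z ≠ 0 := by rintro rfl; simp at him
  have hπ : z.arg ≠ Real.pi := fun h => him (Complex.arg_eq_pi_iff.mp h).2
  have hlog : Complex.log z = (z.arg : ℂ) * Complex.I := by simp [Complex.log, hz]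
  have hre : z.re = Real.cos z.arg := by rw [Complex.cos_arg hz0, hz, div_one]
  have e1 : ∀ n : ℤ, (k : ℂ) = -4 * Complex.I * Complex.log z + 8 * Real.pi * n ↔
      k = 4 * z.arg + 8 * Real.pi * n := fun n => by
    rw [hlog, ← Complex.ofReal_inj]
    push_cast
    rw [show -4 * Complex.I * (z.arg * Complex.I) = 4 * z.arg by
      linear_combination (-4 * (z.arg : ℂ)) * Complex.I_mul_I]
  have e2 : ∀ n : ℤ, (k : ℂ) = -4 * Complex.I * Complex.log (starRingEnd ℂ z) + 8 * Real.pi * n ↔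
      k = -4 * z.arg + 8 * Real.pi * n := fun n => by
    rw [Complex.log_conj _ hπ, hlog, ← Complex.ofReal_inj, map_mul, Complex.conj_ofReal,
      Complex.conj_I]
    push_cast
    rw [show -4 * Complex.I * (z.arg * -Complex.I) = -4 * z.arg by
      linear_combination (4 * (z.arg : ℂ)) * Complex.I_mul_I]
  simp only [e1, e2]
  rw [hre, eq_comm (a := Real.cos (k / 4)), Real.cos_eq_cos_iff]
  refine exists_congr fun n => or_congr ?_ ?_ <;> constructor <;> intro h <;> linarith

theorem exists_eq_eight_pi_iff (k : ℝ) :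
    (∃ n : ℤ, k = 8 * Real.pi * n) ↔ Real.cos (k / 4) = 1 := by
  rw [Real.cos_eq_one_iff]
  refine exists_congr fun n => ?_
  constructor <;> intro h <;> linarith

theorem exists_eq_eight_pi_div_three_iff (k : ℝ) :
    (∃ n : ℤ, k = 8 * Real.pi / 3 + 8 * Real.pi * n ∨ k = -(8 * Real.pi / 3) + 8 * Real.pi * n) ↔
      Real.cos (k / 4) = -1 / 2 := by
  have h : Real.cos (2 * Real.pi / 3) = -1 / 2 := by
    rw [show 2 * Real.pi / 3 = Real.pi - Real.pi / 3 by ring, Real.cos_pi_sub, Real.cos_pi_div_three]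
    norm_num
  rw [← h, eq_comm (a := Real.cos (k / 4)), Real.cos_eq_cos_iff]
  refine exists_congr fun n => or_congr ?_ ?_ <;> constructor <;> intro h <;> linarith

theorem sqrt_thirtyThree_lt : Real.sqrt 33 < 17 := by
  rw [Real.sqrt_lt' (by norm_num)]
  norm_num

theorem re_z₁ : z₁.re = (-3 - Real.sqrt 33) / 12 := by
  simp [z₁, Complex.mul_re]
  ring

theorem im_z₁ : z₁.im = -Real.sqrt (102 - 6 * Real.sqrt 33) / 12 := by
  simp [z₁, Complex.mul_im]
  ring

theorem re_z₂ : z₂.re = (-3 + Real.sqrt 33) / 12 := by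
  simp [z₂, Complex.mul_re]
  ring

theorem im_z₂ : z₂.im = -Real.sqrt (102 + 6 * Real.sqrt 33) / 12 := by
  simp [z₂, Complex.mul_im]
  ring

theorem norm_z₁ : ‖z₁‖ = 1 := by
  rw [← sq_eq_sq₀ (norm_nonneg _) zero_le_one, ← Complex.normSq_eq_norm_sq, Complex.normSq_apply,
    re_z₁, im_z₁]
  have h := Real.sq_sqrt (show 0 ≤ 102 - 6 * Real.sqrt 33 by linarith [sqrt_thirtyThree_lt])
  linear_combination h / 144 + Real.sq_sqrt (show (0:ℝ) ≤ 33 by norm_num) / 144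

theorem norm_z₂ : ‖z₂‖ = 1 := by
  rw [← sq_eq_sq₀ (norm_nonneg _) zero_le_one, ← Complex.normSq_eq_norm_sq, Complex.normSq_apply,
    re_z₂, im_z₂]
  have h := Real.sq_sqrt (show 0 ≤ 102 + 6 * Real.sqrt 33 by positivity)
  linear_combination h / 144 + Real.sq_sqrt (show (0:ℝ) ≤ 33 by norm_num) / 144

theorem im_z₁_ne_zero : z₁.im ≠ 0 := by
  have h : 0 < Real.sqrt (102 - 6 * Real.sqrt 33) :=
    Real.sqrt_pos.mpr (by linarith [sqrt_thirtyThree_lt])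
  rw [im_z₁]
  linarith

theorem im_z₂_ne_zero : z₂.im ≠ 0 := by
  have h : 0 < Real.sqrt (102 + 6 * Real.sqrt 33) := by positivity
  rw [im_z₂]
  linarith

theorem secular_factor_eq_zero_iff (c : ℝ) :
    (c - 1) * (2 * c + 1) * (6 * c ^ 2 + 3 * c - 1) = 0 ↔
      c = 1 ∨ c = -1 / 2 ∨ c = z₁.re ∨ c = z₂.re := by
  have h : 6 * c ^ 2 + 3 * c - 1 = 6 * ((c - z₁.re) * (c - z₂.re)) := by
    rw [re_z₁, re_z₂]
    linear_combination Real.sq_sqrt (show (0:ℝ) ≤ 33 by norm_num) / 24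
  have h2 : 2 * c + 1 = 2 * (c - -1 / 2) := by ring
  rw [h, h2]
  simp [sub_eq_zero, or_assoc]

theorem lollipop_eigenvalue_characterization (k : ℝ) (hk : 0 < k) :
    (∃ (u v : ℝ → ℝ),
      ContDiffOn ℝ 2 u (Set.Icc 0 (3/4)) ∧
      ContDiffOn ℝ 2 v (Set.Icc 0 (1/4)) ∧
      (∀ x ∈ Set.Icc (0:ℝ) (3/4),
        -derivWithin (derivWithin u (Set.Icc 0 (3/4))) (Set.Icc 0 (3/4)) x = k ^ 2 * u x) ∧
      (∀ x ∈ Set.Icc (0:ℝ) (1/4),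
        -derivWithin (derivWithin v (Set.Icc 0 (1/4))) (Set.Icc 0 (1/4)) x = k ^ 2 * v x) ∧
      u 0 = u (3/4) ∧ u (3/4) = v 0 ∧
      derivWithin u (Set.Icc 0 (3/4)) 0 - derivWithin u (Set.Icc 0 (3/4)) (3/4)
        + derivWithin v (Set.Icc 0 (1/4)) 0 = 0 ∧
      derivWithin v (Set.Icc 0 (1/4)) (1/4) = 0 ∧
      ((∃ x ∈ Set.Icc (0:ℝ) (3/4), u x ≠ 0) ∨ (∃ x ∈ Set.Icc (0:ℝ) (1/4), v x ≠ 0)))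
    ↔ ∃ n : ℤ,
        k = 8 * Real.pi * n ∨
        k = 8 * Real.pi / 3 + 8 * Real.pi * n ∨
        k = -(8 * Real.pi / 3) + 8 * Real.pi * n ∨
        (k : ℂ) = -4 * Complex.I * Complex.log z₁ + 8 * Real.pi * n ∨
        (k : ℂ) = -4 * Complex.I * Complex.log (starRingEnd ℂ z₁) + 8 * Real.pi * n ∨
        (k : ℂ) = -4 * Complex.I * Complex.log z₂ + 8 * Real.pi * n ∨
        (k : ℂ) = -4 * Complex.I * Complex.log (starRingEnd ℂ z₂) + 8 * Real.pi * n := by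
  rw [exists_lollipop_eigenfunction_iff hk, exists_vertexConditions_iff,
    secular_factor_eq_zero_iff, ← exists_eq_eight_pi_iff, ← exists_eq_eight_pi_div_three_iff,
    ← exists_eq_log_iff_cos_eq_re norm_z₁ im_z₁_ne_zero,
    ← exists_eq_log_iff_cos_eq_re norm_z₂ im_z₂_ne_zero]
  simp only [← exists_or, or_assoc]
end
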